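/- Let K be a field of characteristic zero and n, m ≥ 1. The K-algebra homomorphism φ : B_n ⊗_K B_m → B_{n+m} determined by sending the generators X_i ⊗ 1, Y_i ⊗ 1 (1 ≤ i ≤ n) to X_i, Y_i, sending 1 ⊗ X_j, 1 ⊗ Y_j (1 ≤ j ≤ m) to X_{n+j}, Y_{n+j}, and sending both Z ⊗ 1 and 1 ⊗ Z to Z, is surjective and its kernel is the two-sided ideal of B_n ⊗_K B_m generated by the element Z ⊗ 1 − 1 ⊗ Z. Consequently there is an isomorphism of graded K-algebras B_{n+m} ≅ (B_n ⊗_K B_m)/(Z ⊗ 1 − 1 ⊗ Z)(B_n ⊗_K B_m). -/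

import Mathlib

/-! Prelude: the homogenized Weyl algebra `B_n`. -/

noncomputable section

/-- Generators of the homogenized Weyl algebra `B_n`:
`X 0, …, X (n-1)`, `Y 0, …, Y (n-1)` and `Z`. -/
inductive BGen (n : ℕ) : Type
  | X : Fin n → BGen n
  | Y : Fin n → BGen n
  | Z : BGen n

/-- The defining relations of the homogenized Weyl algebra `B_n`:
`X_i Y_j = Y_j X_i + δ_{ij} Z²`, `X_i X_j = X_j X_i`, `Y_i Y_j = Y_j Y_i`,
`X_i Z = Z X_i`, `Y_i Z = Z Y_i`. -/
inductive BRel (K : Type) [CommRing K] (n : ℕ) :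
    FreeAlgebra K (BGen n) → FreeAlgebra K (BGen n) → Prop
  | xy (i j : Fin n) : BRel K n (FreeAlgebra.ι K (BGen.X i) * FreeAlgebra.ι K (BGen.Y j))
      (FreeAlgebra.ι K (BGen.Y j) * FreeAlgebra.ι K (BGen.X i) +
        if i = j then (FreeAlgebra.ι K (BGen.Z : BGen n)) ^ 2 else 0)
  | xx (i j : Fin n) : BRel K n (FreeAlgebra.ι K (BGen.X i) * FreeAlgebra.ι K (BGen.X j))
      (FreeAlgebra.ι K (BGen.X j) * FreeAlgebra.ι K (BGen.X i))
  | yy (i j : Fin n) : BRel K n (FreeAlgebra.ι K (BGen.Y i) * FreeAlgebra.ι K (BGen.Y j))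
      (FreeAlgebra.ι K (BGen.Y j) * FreeAlgebra.ι K (BGen.Y i))
  | xz (i : Fin n) : BRel K n (FreeAlgebra.ι K (BGen.X i) * FreeAlgebra.ι K (BGen.Z : BGen n))
      (FreeAlgebra.ι K (BGen.Z : BGen n) * FreeAlgebra.ι K (BGen.X i))
  | yz (i : Fin n) : BRel K n (FreeAlgebra.ι K (BGen.Y i) * FreeAlgebra.ι K (BGen.Z : BGen n))
      (FreeAlgebra.ι K (BGen.Z : BGen n) * FreeAlgebra.ι K (BGen.Y i))

/-- The homogenized Weyl algebra `B_n` over `K`. -/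
def HWeyl (K : Type) [CommRing K] (n : ℕ) : Type := RingQuot (BRel K n)

instance (K : Type) [CommRing K] (n : ℕ) : Ring (HWeyl K n) :=
  inferInstanceAs (Ring (RingQuot (BRel K n)))

instance (K : Type) [CommRing K] (n : ℕ) : Algebra K (HWeyl K n) :=
  inferInstanceAs (Algebra K (RingQuot (BRel K n)))

/-- The canonical degree-one generators of `B_n`. -/
def HWeyl.gen (K : Type) [CommRing K] {n : ℕ} (w : BGen n) : HWeyl K n :=
  RingQuot.mkAlgHom K (BRel K n) (FreeAlgebra.ι K w)

/-- A `K`-algebra automorphism of `B_n` is *grade preserving* provided it maps the span of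
the degree one generators into itself (as `B_n` is generated in degree one, this is
equivalent to preserving every homogeneous component). -/
def HWeyl.GradePreserving {K : Type} [CommRing K] {n : ℕ}
    (f : HWeyl K n ≃ₐ[K] HWeyl K n) : Prop :=
  ∀ w : BGen n, f (HWeyl.gen K w) ∈ Submodule.span K (Set.range (HWeyl.gen K (n := n)))


/-- The two-sided ideal of a ring `R` generated by an element `z`: the additive subgroup
generated by all products `a * z * b`.  Membership in this subgroup is membership in the
two-sided ideal generated by `z`. -/
def twoSidedSpan {R : Type*} [Ring R] (z : R) : AddSubgroup R :=
  AddSubgroup.closure {y | ∃ a b : R, y = a * z * b}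


open scoped TensorProduct

namespace HWeyl

variable {K : Type} [CommRing K] {n m : ℕ} {A : Type*} [Ring A] [Algebra K A]

/-- A family of elements of a ring, indexed by the generators of `B_n`, that satisfies the
defining relations of `B_n`. -/
structure Relations (f : BGen n → A) : Prop where
  xy (i j : Fin n) : f (.X i) * f (.Y j) = f (.Y j) * f (.X i) + if i = j then f .Z ^ 2 else 0
  xx (i j : Fin n) : f (.X i) * f (.X j) = f (.X j) * f (.X i)
  yy (i j : Fin n) : f (.Y i) * f (.Y j) = f (.Y j) * f (.Y i)
  xz (i : Fin n) : f (.X i) * f .Z = f .Z * f (.X i)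
  yz (i : Fin n) : f (.Y i) * f .Z = f .Z * f (.Y i)

lemma relations_algHom_gen (a : HWeyl K n →ₐ[K] A) : Relations fun w => a (gen K w) := by
  have key {u v} (h : BRel K n u v) : a (RingQuot.mkAlgHom K (BRel K n) u) =
      a (RingQuot.mkAlgHom K (BRel K n) v) :=
    congrArg a (RingQuot.mkAlgHom_rel K h)
  have hmul (u v : FreeAlgebra K (BGen n)) : a (RingQuot.mkAlgHom K (BRel K n) (u * v)) =
      a (RingQuot.mkAlgHom K (BRel K n) u) * a (RingQuot.mkAlgHom K (BRel K n) v) := by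
    rw [map_mul]
    exact map_mul a _ _
  refine ⟨fun i j => ?_, fun i j => ?_, fun i j => ?_, fun i => ?_, fun i => ?_⟩
  · have h := key (.xy i j)
    rw [map_add] at h
    replace h := h.trans (map_add a _ _)
    split_ifs at h ⊢
    · simpa only [sq, hmul] using! h
    · rw [map_zero] at h
      replace h := h.trans (congrArg _ (map_zero a))
      simpa only [hmul] using! h
  · simpa only [hmul] using! key (.xx i j)
  · simpa only [hmul] using! key (.yy i j)
  · simpa only [hmul] using! key (.xz i)
  · simpa only [hmul] using! key (.yz i)

/-- The universal property of `B_n`. -/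
def lift (f : BGen n → A) (hf : Relations f) : HWeyl K n →ₐ[K] A :=
  RingQuot.liftAlgHom K ⟨FreeAlgebra.lift K f, by
    intro u v h
    cases h with
    | xy i j =>
      have := hf.xy i j
      split_ifs at this ⊢ <;> simpa using this
    | xx i j => simpa using hf.xx i j
    | yy i j => simpa using hf.yy i j
    | xz i => simpa using hf.xz i
    | yz i => simpa using hf.yz i⟩

@[simp]
lemma lift_gen (f : BGen n → A) (hf : Relations f) (w : BGen n) :
    lift (K := K) f hf (gen K w) = f w :=
  (RingQuot.liftAlgHom_mkAlgHom_apply K _ _ _).trans (FreeAlgebra.lift_ι_apply f w)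

@[ext]
lemma algHom_ext {f g : HWeyl K n →ₐ[K] A} (h : ∀ w, f (gen K w) = g (gen K w)) : f = g :=
  RingQuot.ringQuot_ext' K f g (FreeAlgebra.hom_ext (funext h))

lemma adjoin_range_gen : Algebra.adjoin K (Set.range (gen K (n := n))) = ⊤ := by
  have h : Set.range (gen K (n := n)) =
      RingQuot.mkAlgHom K (BRel K n) '' Set.range (FreeAlgebra.ι K) :=
    Set.range_comp (RingQuot.mkAlgHom K (BRel K n)) (FreeAlgebra.ι K)
  rw [h]
  refine (AlgHom.map_adjoin (RingQuot.mkAlgHom K (BRel K n)) _).symm.trans ?_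
  rw [FreeAlgebra.adjoin_range_ι, Algebra.map_top]
  exact (AlgHom.range_eq_top _).2 (RingQuot.mkAlgHom_surjective K (BRel K n))

lemma commute_of_commute_gen (a : HWeyl K n →ₐ[K] A) (b : HWeyl K m →ₐ[K] A)
    (h : ∀ v w, Commute (a (gen K v)) (b (gen K w))) (x : HWeyl K n) (y : HWeyl K m) :
    Commute (a x) (b y) := by
  have hx : x ∈ Algebra.adjoin K (Set.range (gen K (n := n))) :=
    adjoin_range_gen (K := K) ▸ Algebra.mem_top
  have hy : y ∈ Algebra.adjoin K (Set.range (gen K (n := m))) :=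
    adjoin_range_gen (K := K) ▸ Algebra.mem_top
  induction hx using Algebra.adjoin_induction with
  | algebraMap r => rw [AlgHom.commutes]; exact Algebra.commutes r _
  | add u v _ _ hu hv => rw [map_add]; exact hu.add_left hv
  | mul u v _ _ hu hv => rw [map_mul]; exact hu.mul_left hv
  | mem u hu =>
    obtain ⟨v, rfl⟩ := hu
    induction hy using Algebra.adjoin_induction with
    | algebraMap r => rw [AlgHom.commutes]; exact (Algebra.commutes r _).symm
    | add u v _ _ hu hv => rw [map_add]; exact hu.add_right hv
    | mul u v _ _ hu hv => rw [map_mul]; exact hu.mul_right hv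
    | mem u hu =>
      obtain ⟨w, rfl⟩ := hu
      exact h v w

/-- The map on generators induced by a map of indices. -/
def _root_.BGen.map (e : Fin n → Fin m) : BGen n → BGen m
  | .X i => .X (e i)
  | .Y i => .Y (e i)
  | .Z => .Z

variable (K) in
lemma relations_gen : Relations fun w : BGen n => gen K w :=
  relations_algHom_gen (AlgHom.id K _)

variable (K) in
/-- The homomorphism `B_n → B_m` induced by an injective map of indices. -/
def map (e : Fin n ↪ Fin m) : HWeyl K n →ₐ[K] HWeyl K m :=
  lift (fun w => gen K (w.map e))
    { xy i j := by simpa only [BGen.map, e.injective.eq_iff] using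
        (relations_gen K).xy (e i) (e j)
      xx i j := (relations_gen K).xx (e i) (e j)
      yy i j := (relations_gen K).yy (e i) (e j)
      xz i := (relations_gen K).xz (e i)
      yz i := (relations_gen K).yz (e i) }

@[simp]
lemma map_gen (e : Fin n ↪ Fin m) (w : BGen n) : map K e (gen K w) = gen K (w.map e) :=
  lift_gen _ _ w

lemma commute_gen_map {k : ℕ} (e : Fin n → Fin k) (e' : Fin m → Fin k) (h : ∀ i j, e i ≠ e' j)
    (v : BGen n) (w : BGen m) :
    Commute (gen K (v.map e)) (gen K (w.map e')) := by
  have hr := relations_gen K (n := k)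
  cases v with
  | X i =>
    cases w with
    | X j => exact hr.xx _ _
    | Y j => simpa [h i j] using! hr.xy (e i) (e' j)
    | Z => exact hr.xz _
  | Y i =>
    cases w with
    | X j => exact Eq.symm (by simpa [(h i j).symm] using! hr.xy (e' j) (e i))
    | Y j => exact hr.yy _ _
    | Z => exact hr.yz _
  | Z =>
    cases w with
    | X j => exact (hr.xz _).symm
    | Y j => exact (hr.yz _).symm
    | Z => exact rfl

variable (K n m) in
/-- The homomorphism `B_n ⊗ B_m → B_{n+m}` that concatenates the generators and identifies
both copies of `Z`. -/
def tensorHom : HWeyl K n ⊗[K] HWeyl K m →ₐ[K] HWeyl K (n + m) :=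
  Algebra.TensorProduct.lift (map K (Fin.castAddEmb m)) (map K (Fin.natAddEmb n))
    (commute_of_commute_gen _ _ fun v w => by
      rw [map_gen, map_gen]
      refine commute_gen_map _ _ (fun i j => ?_) v w
      simp [Fin.ext_iff]
      omega)

@[simp]
lemma tensorHom_gen_tmul_one (w : BGen n) :
    tensorHom K n m (gen K w ⊗ₜ 1) = gen K (w.map (Fin.castAdd m)) := by
  rw [tensorHom, Algebra.TensorProduct.lift_tmul, map_one, mul_one, map_gen]
  rfl

@[simp]
lemma tensorHom_one_tmul_gen (w : BGen m) :
    tensorHom K n m ((1 : HWeyl K n) ⊗ₜ gen K w) = gen K (w.map (Fin.natAdd n)) := by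
  rw [tensorHom, Algebra.TensorProduct.lift_tmul, map_one, one_mul, map_gen]
  rfl

lemma tensorHom_surjective : Function.Surjective (tensorHom K n m) := by
  rw [← AlgHom.range_eq_top, eq_top_iff, ← adjoin_range_gen, Algebra.adjoin_le_iff]
  rintro _ ⟨w, rfl⟩
  cases w with
  | X i =>
    cases i using Fin.addCases with
    | left i => exact ⟨_, tensorHom_gen_tmul_one (.X i)⟩
    | right j => exact ⟨_, tensorHom_one_tmul_gen (.X j)⟩
  | Y i =>
    cases i using Fin.addCases with
    | left i => exact ⟨_, tensorHom_gen_tmul_one (.Y i)⟩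
    | right j => exact ⟨_, tensorHom_one_tmul_gen (.Y j)⟩
  | Z => exact ⟨_, tensorHom_gen_tmul_one .Z⟩

/-- The family indexed by the generators of `B_{n+m}` that concatenates two families, taking the
value at `Z` from the first. -/
def _root_.BGen.append {B : Type*} (f : BGen n → B) (g : BGen m → B) : BGen (n + m) → B
  | .X i => Fin.append (fun i => f (.X i)) (fun j => g (.X j)) i
  | .Y i => Fin.append (fun i => f (.Y i)) (fun j => g (.Y j)) i
  | .Z => f .Z

lemma Relations.append {f : BGen n → A} {g : BGen m → A} (hf : Relations f) (hg : Relations g)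
    (hfg : ∀ v w, Commute (f v) (g w)) (hz : f .Z = g .Z) : Relations (BGen.append f g) where
  xy i j := by
    cases i using Fin.addCases with
    | left i =>
      cases j using Fin.addCases with
      | left j => simpa [BGen.append] using hf.xy i j
      | right j =>
        have hij : Fin.castAdd m i ≠ Fin.natAdd n j := by simp [Fin.ext_iff]; omega
        simpa [BGen.append, hij] using! hfg (.X i) (.Y j)
    | right i =>
      cases j using Fin.addCases with
      | left j =>
        have hij : Fin.natAdd n i ≠ Fin.castAdd m j := by simp [Fin.ext_iff]; omega
        simpa [BGen.append, hij] using! (hfg (.Y j) (.X i)).symm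
      | right j => simpa [BGen.append, hz] using hg.xy i j
  xx i j := by
    cases i using Fin.addCases with
    | left i =>
      cases j using Fin.addCases with
      | left j => simpa [BGen.append] using hf.xx i j
      | right j => simpa [BGen.append] using! hfg (.X i) (.X j)
    | right i =>
      cases j using Fin.addCases with
      | left j => simpa [BGen.append] using! (hfg (.X j) (.X i)).symm
      | right j => simpa [BGen.append] using hg.xx i j
  yy i j := by
    cases i using Fin.addCases with
    | left i =>
      cases j using Fin.addCases with
      | left j => simpa [BGen.append] using hf.yy i j
      | right j => simpa [BGen.append] using! hfg (.Y i) (.Y j)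
    | right i =>
      cases j using Fin.addCases with
      | left j => simpa [BGen.append] using! (hfg (.Y j) (.Y i)).symm
      | right j => simpa [BGen.append] using hg.yy i j
  xz i := by
    cases i using Fin.addCases with
    | left i => simpa [BGen.append] using hf.xz i
    | right j => simpa [BGen.append, hz] using hg.xz j
  yz i := by
    cases i using Fin.addCases with
    | left i => simpa [BGen.append] using hf.yz i
    | right j => simpa [BGen.append, hz] using hg.yz j

/-- Every homomorphism from `B_n ⊗ B_m` that identifies both copies of `Z` factors through
`B_{n+m}`. -/
lemma exists_comp_tensorHom_eq (q : HWeyl K n ⊗[K] HWeyl K m →ₐ[K] A)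
    (hq : q (gen K .Z ⊗ₜ 1) = q (1 ⊗ₜ gen K .Z)) :
    ∃ ψ : HWeyl K (n + m) →ₐ[K] A, ψ.comp (tensorHom K n m) = q := by
  let a := q.comp Algebra.TensorProduct.includeLeft
  let b := q.comp Algebra.TensorProduct.includeRight
  refine ⟨lift _ ((relations_algHom_gen a).append (relations_algHom_gen b)
    (fun v w => Commute.map ((Commute.one_right _).tmul (Commute.one_left _)) q) hq), ?_⟩
  ext w
  · change lift _ _ (tensorHom K n m (gen K w ⊗ₜ 1)) = a (gen K w)
    rw [tensorHom_gen_tmul_one, lift_gen]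
    cases w <;> simp [BGen.append, BGen.map]
  · change lift _ _ (tensorHom K n m (1 ⊗ₜ gen K w)) = b (gen K w)
    rw [tensorHom_one_tmul_gen, lift_gen]
    cases w with
    | Z => exact hq
    | _ => simp [BGen.append, BGen.map]

end HWeyl

open scoped Pointwise in
lemma mem_twoSidedSpan_iff {R : Type*} [Ring R] {x z : R} :
    x ∈ twoSidedSpan z ↔ x ∈ TwoSidedIdeal.span {z} := by
  rw [TwoSidedIdeal.mem_span_iff_mem_addSubgroup_closure, twoSidedSpan]
  have h : {y | ∃ a b : R, y = a * z * b} = Set.univ * ({z} : Set R) * Set.univ := by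
    ext y
    simp [Set.mem_mul, eq_comm]
  rw [h]

lemma HWeyl.tensorHom_eq_zero_iff {K : Type} [CommRing K] {n m : ℕ}
    (x : HWeyl K n ⊗[K] HWeyl K m) :
    tensorHom K n m x = 0 ↔ x ∈ twoSidedSpan (gen K (BGen.Z : BGen n) ⊗ₜ (1 : HWeyl K m)
      - (1 : HWeyl K n) ⊗ₜ gen K (BGen.Z : BGen m)) := by
  rw [mem_twoSidedSpan_iff]
  set z := gen K (BGen.Z : BGen n) ⊗ₜ[K] (1 : HWeyl K m) - 1 ⊗ₜ gen K (BGen.Z : BGen m) with hz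
  constructor
  · intro hx
    let c := (TwoSidedIdeal.span {z}).ringCon
    obtain ⟨ψ, hψ⟩ := exists_comp_tensorHom_eq (c.mkₐ K)
      (c.eq.2 ((TwoSidedIdeal.rel_iff _ _ _).2 (TwoSidedIdeal.subset_span rfl)))
    rw [TwoSidedIdeal.mem_iff]
    refine c.eq.1 ?_
    change c.mkₐ K x = c.mkₐ K 0
    rw [← hψ, AlgHom.comp_apply, hx, map_zero, map_zero]
  · rw [← TwoSidedIdeal.mem_ker]
    refine fun hx => TwoSidedIdeal.span_le.2 ?_ hx
    rw [Set.singleton_subset_iff, SetLike.mem_coe, TwoSidedIdeal.mem_ker, hz, map_sub,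
      tensorHom_gen_tmul_one, tensorHom_one_tmul_gen]
    exact sub_self _

/-- Let `K` be a field of characteristic zero and `n, m ≥ 1`.  The
`K`-algebra homomorphism `φ : B_n ⊗_K B_m → B_{n+m}` determined by `X_i ⊗ 1 ↦ X_i`,
`Y_i ⊗ 1 ↦ Y_i`, `1 ⊗ X_j ↦ X_{n+j}`, `1 ⊗ Y_j ↦ Y_{n+j}`, `Z ⊗ 1 ↦ Z`, `1 ⊗ Z ↦ Z`
is surjective and its kernel is the two-sided ideal generated by `Z ⊗ 1 − 1 ⊗ Z`;
consequently `B_{n+m} ≅ (B_n ⊗_K B_m)/(Z ⊗ 1 − 1 ⊗ Z)(B_n ⊗_K B_m)` as graded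
`K`-algebras. -/
theorem hweyl_tensor_surjection_kernel
    (K : Type) [Field K] [CharZero K] (n m : ℕ) (hn : 1 ≤ n) (hm : 1 ≤ m) :
    ∃ φ : (HWeyl K n ⊗[K] HWeyl K m) →ₐ[K] HWeyl K (n + m),
      (∀ i : Fin n, φ (HWeyl.gen K (BGen.X i) ⊗ₜ 1)
          = HWeyl.gen K (BGen.X (Fin.castAdd m i))) ∧
      (∀ i : Fin n, φ (HWeyl.gen K (BGen.Y i) ⊗ₜ 1)
          = HWeyl.gen K (BGen.Y (Fin.castAdd m i))) ∧
      (∀ j : Fin m, φ ((1 : HWeyl K n) ⊗ₜ HWeyl.gen K (BGen.X j))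
          = HWeyl.gen K (BGen.X (Fin.natAdd n j))) ∧
      (∀ j : Fin m, φ ((1 : HWeyl K n) ⊗ₜ HWeyl.gen K (BGen.Y j))
          = HWeyl.gen K (BGen.Y (Fin.natAdd n j))) ∧
      (φ (HWeyl.gen K (BGen.Z : BGen n) ⊗ₜ 1) = HWeyl.gen K (BGen.Z : BGen (n + m))) ∧
      (φ ((1 : HWeyl K n) ⊗ₜ HWeyl.gen K (BGen.Z : BGen m))
          = HWeyl.gen K (BGen.Z : BGen (n + m))) ∧
      Function.Surjective φ ∧
      (∀ x : HWeyl K n ⊗[K] HWeyl K m, φ x = 0 ↔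
        x ∈ twoSidedSpan (HWeyl.gen K (BGen.Z : BGen n) ⊗ₜ (1 : HWeyl K m)
          - (1 : HWeyl K n) ⊗ₜ HWeyl.gen K (BGen.Z : BGen m))) := by
  exact ⟨HWeyl.tensorHom K n m,
    fun i => HWeyl.tensorHom_gen_tmul_one (.X i), fun i => HWeyl.tensorHom_gen_tmul_one (.Y i),
    fun j => HWeyl.tensorHom_one_tmul_gen (.X j), fun j => HWeyl.tensorHom_one_tmul_gen (.Y j),
    HWeyl.tensorHom_gen_tmul_one .Z, HWeyl.tensorHom_one_tmul_gen .Z,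
    HWeyl.tensorHom_surjective, HWeyl.tensorHom_eq_zero_iff⟩
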